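/- Let Φ, Φ̃ ∈ C_c^∞(ℝ^n × ℝ^n) and suppose Φ satisfies condition (A) (with d = 2n). Then there exists a constant c, depending only on n, Φ, and Φ̃, such that for every L^∞ matrix A = (a_{μν})_{μ,ν∈ℤ^n} one has ‖σ_{A,Φ̃}‖_{M(L²×L² → (L²,ℓ^∞))} ≤ c ‖σ_{A,Φ}‖_{M(L²×L² → (L²,ℓ^∞))}. -/

import Mathlib

open MeasureTheory Complex
open scoped ENNReal NNReal

noncomputable section

abbrev Rn (n : ℕ) : Type := Fin n → ℝ
abbrev Zn (n : ℕ) : Type := Fin n → ℤ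

/-- Coercion of a lattice point to a point of `ℝ^n`. -/
def coeZ {n : ℕ} (μ : Zn n) : Rn n := fun i => (μ i : ℝ)

/-- The cube `aQ = [-a/2, a/2]^n`. -/
def cube (n : ℕ) (a : ℝ) : Set (Rn n) := Set.univ.pi fun _ => Set.Icc (-a / 2) (a / 2)

/-- A smooth compactly supported function. -/
def IsCcInfty {E : Type*} [NormedAddCommGroup E] [NormedSpace ℝ E] (Φ : E → ℂ) : Prop :=
  ContDiff ℝ (⊤ : ℕ∞) Φ ∧ HasCompactSupport Φ

/-- The Fourier transform of a Schwartz function. -/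
def ft {n : ℕ} (f : SchwartzMap (Rn n) ℂ) (ξ : Rn n) : ℂ :=
  ∫ x : Rn n, Complex.exp ((-2 * Real.pi * Complex.I) * ((∑ i, x i * ξ i : ℝ) : ℂ)) * f x

/-- The bilinear Fourier multiplier operator `T_σ(f,g)`. -/
def Tbil {n : ℕ} (σ : Rn n × Rn n → ℂ) (f g : SchwartzMap (Rn n) ℂ) (x : Rn n) : ℂ :=
  ∫ p : Rn n × Rn n,
    Complex.exp ((2 * Real.pi * Complex.I) * ((∑ i, x i * (p.1 i + p.2 i) : ℝ) : ℂ)) *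
      σ p * ft f p.1 * ft g p.2

/-- `L²` norm of `h(·+ν)` on the unit cube `Q`. -/
def localL2 {n : ℕ} (h : Rn n → ℂ) (ν : Zn n) : ℝ≥0∞ :=
  (∫⁻ x in cube n 1, (‖h (x + coeZ ν)‖₊ : ℝ≥0∞) ^ 2) ^ (1 / 2 : ℝ)

/-- The amalgam `(L², ℓ^q)` norm. -/
def amalgamNorm {n : ℕ} (q : ℝ≥0∞) (h : Rn n → ℂ) : ℝ≥0∞ :=
  if q = ∞ then ⨆ ν : Zn n, localL2 h ν
  else (∑' ν : Zn n, localL2 h ν ^ q.toReal) ^ (1 / q.toReal)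

/-- The multiplier norm `‖σ‖_{M(L²×L² → (L²,ℓ^q))}`. -/
def multNorm {n : ℕ} (q : ℝ≥0∞) (σ : Rn n × Rn n → ℂ) : ℝ≥0∞ :=
  ⨆ (f : SchwartzMap (Rn n) ℂ) (g : SchwartzMap (Rn n) ℂ)
    (_ : eLpNorm (⇑f) 2 volume = 1) (_ : eLpNorm (⇑g) 2 volume = 1),
    amalgamNorm q (Tbil σ f g)

/-- An `L^∞` matrix on `ℤ^n × ℤ^n`. -/
def IsLinftyMatrix {n : ℕ} (A : Zn n → Zn n → ℂ) : Prop :=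
  ∃ C : ℝ, ∀ μ ν, ‖A μ ν‖ ≤ C

/-- The norm `‖A‖_B`: the trilinear form norm over finitely supported unit `ℓ²` vectors. -/
def normB {n : ℕ} (A : Zn n → Zn n → ℂ) : ℝ≥0∞ :=
  ⨆ (F : Zn n →₀ ℂ) (G : Zn n →₀ ℂ) (H : Zn n →₀ ℂ)
    (_ : ∑ μ ∈ F.support, ‖F μ‖ ^ 2 = 1)
    (_ : ∑ ν ∈ G.support, ‖G ν‖ ^ 2 = 1)
    (_ : ∑ ρ ∈ H.support, ‖H ρ‖ ^ 2 = 1),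
    (‖∑ μ ∈ F.support, ∑ ν ∈ G.support, A μ ν * F μ * G ν * H (μ + ν)‖₊ : ℝ≥0∞)

/-- The multiplier `σ_{A,Φ}(ξ,η) = Σ_{μ,ν} a_{μν} Φ(ξ-μ, η-ν)`. -/
def sigmaA {n : ℕ} (A : Zn n → Zn n → ℂ) (Φ : Rn n × Rn n → ℂ) (p : Rn n × Rn n) : ℂ :=
  ∑' μν : Zn n × Zn n, A μν.1 μν.2 * Φ (p.1 - coeZ μν.1, p.2 - coeZ μν.2)

/-- Condition (A) for functions on `ℝ^d`. -/
def ConditionA {d : ℕ} (Φ : Rn d → ℂ) : Prop :=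
  ∃ Θ : Rn d → ℂ, ContDiff ℝ (⊤ : ℕ∞) Θ ∧ HasCompactSupport Θ ∧
    ∀ α : Zn d, (∫ x : Rn d, Θ x * Φ (x - coeZ α)) = if α = 0 then 1 else 0

/-- Condition (A) for functions on `ℝ^n × ℝ^n` (i.e. `d = 2n`). -/
def ConditionA2 {n : ℕ} (Φ : Rn n × Rn n → ℂ) : Prop :=
  ∃ Θ : Rn n × Rn n → ℂ, ContDiff ℝ (⊤ : ℕ∞) Θ ∧ HasCompactSupport Θ ∧
    ∀ α β : Zn n, (∫ p : Rn n × Rn n, Θ p * Φ (p.1 - coeZ α, p.2 - coeZ β)) =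
      if α = 0 ∧ β = 0 then 1 else 0

/-- Condition (A) for functions on `ℝ` (the case `d = 1`). -/
def ConditionA1 (Φ : ℝ → ℂ) : Prop :=
  ∃ θ : ℝ → ℂ, ContDiff ℝ (⊤ : ℕ∞) θ ∧ HasCompactSupport θ ∧
    ∀ j : ℤ, (∫ x : ℝ, θ x * Φ (x - (j : ℝ))) = if j = 0 then 1 else 0

/-- The `L^∞` (sup) norm, valued in `ℝ≥0∞`. -/
def supNorm {E : Type*} (u : E → ℂ) : ℝ≥0∞ := ⨆ x, (‖u x‖₊ : ℝ≥0∞)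

end

open scoped FourierTransform

/-- The standard character `t ↦ e^{2πit}` with values in `ℂ`. -/
noncomputable def expChar (t : ℝ) : ℂ := (𝐞 t : ℂ)

lemma expChar_eq (t : ℝ) : expChar t = Complex.exp (2 * Real.pi * Complex.I * t) := by
  rw [expChar, Real.fourierChar_apply]
  congr 1
  push_cast
  ring

lemma expChar_add (s t : ℝ) : expChar (s + t) = expChar s * expChar t := by
  simp [expChar, AddChar.map_add_eq_mul]

@[simp] lemma norm_expChar (t : ℝ) : ‖expChar t‖ = 1 := Circle.norm_coe _

@[simp] lemma expChar_zero : expChar 0 = 1 := by simp [expChar_eq]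

lemma expChar_int (k : ℤ) : expChar k = 1 := by
  rw [expChar_eq]
  have := Complex.exp_int_mul_two_pi_mul_I k
  rw [← this]
  congr 1
  push_cast
  ring

@[fun_prop] lemma continuous_expChar : Continuous expChar := by
  unfold expChar
  fun_prop

section LatticeSums

variable {E L : Type*} [NormedAddCommGroup E]

open scoped Pointwise in
/-- Translates of a compactly supported function by a closed discrete set form a locally finite
family. -/
lemma exists_finset_translate_eq_zero {ι : L → E}
    (hι : Filter.Tendsto ι Filter.cofinite (Filter.cocompact E)) {h : E → ℂ}
    (hh : HasCompactSupport h) {B : Set E} (hB : IsCompact B) :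
    ∃ S : Finset L, ∀ x ∈ B, ∀ m ∉ S, h (x - ι m) = 0 := by
  have hK : IsCompact (B - tsupport h) := by
    rw [sub_eq_add_neg]
    exact IsCompact.add hB (IsCompact.neg hh)
  have hfin : {m | ι m ∈ B - tsupport h}.Finite := by
    have := hι hK.compl_mem_cocompact
    simpa [Filter.mem_cofinite] using! this
  refine ⟨hfin.toFinset, fun x hx m hm => ?_⟩
  by_contra hne
  apply hm
  simp only [Set.Finite.mem_toFinset, Set.mem_ofPred_eq]
  exact ⟨x, hx, x - ι m, subset_tsupport _ hne, by simp⟩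

/-- The sum `∑ m, A m * h (x - ι m)` of weighted translates of `h`. -/
noncomputable def latticeSum (ι : L → E) (A : L → ℂ) (h : E → ℂ) (x : E) : ℂ :=
  ∑' m, A m * h (x - ι m)

lemma exists_finset_latticeSum_eq {ι : L → E}
    (hι : Filter.Tendsto ι Filter.cofinite (Filter.cocompact E)) {h : E → ℂ}
    (hh : HasCompactSupport h) {B : Set E} (hB : IsCompact B) :
    ∃ S : Finset L, ∀ A : L → ℂ, ∀ x ∈ B, latticeSum ι A h x = ∑ m ∈ S, A m * h (x - ι m) := by
  obtain ⟨S, hS⟩ := exists_finset_translate_eq_zero hι hh hB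
  refine ⟨S, fun A x hx => tsum_eq_sum fun m hm => ?_⟩
  rw [hS x hx m hm, mul_zero]

lemma continuous_latticeSum [ProperSpace E] {ι : L → E}
    (hι : Filter.Tendsto ι Filter.cofinite (Filter.cocompact E)) {h : E → ℂ}
    (hh : HasCompactSupport h) (hc : Continuous h) (A : L → ℂ) :
    Continuous (latticeSum ι A h) := by
  rw [continuous_iff_continuousAt]
  intro x
  obtain ⟨S, hS⟩ := exists_finset_latticeSum_eq hι hh (isCompact_closedBall x 1)
  have hcont : Continuous fun y => ∑ m ∈ S, A m * h (y - ι m) := by fun_prop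
  refine hcont.continuousAt.congr ?_
  filter_upwards [Metric.closedBall_mem_nhds x one_pos] with y hy
  exact (hS A y hy).symm

end LatticeSums

/-- The integer lattice point `m` as a vector of `ℝ^d`. -/
def intVec {d : Type*} (m : d → ℤ) : d → ℝ := fun i => (m i : ℝ)

@[simp] lemma intVec_neg {d : Type*} (m : d → ℤ) : intVec (-m) = -intVec m := by
  ext i; simp [intVec]

@[simp] lemma intVec_add {d : Type*} (m k : d → ℤ) : intVec (m + k) = intVec m + intVec k := by
  ext i; simp [intVec]

lemma tendsto_intVec {d : Type*} [Finite d] :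
    Filter.Tendsto (intVec : (d → ℤ) → d → ℝ) Filter.cofinite (Filter.cocompact _) := by
  rw [← Filter.coprodᵢ_cocompact, ← Filter.coprodᵢ_cofinite]
  exact Filter.Tendsto.pi_map_coprodᵢ fun _ => Int.tendsto_coe_cofinite

section Poisson

variable {d : Type*} [Fintype d]

lemma expChar_intVec_dotProduct (k m : d → ℤ) : expChar (intVec k ⬝ᵥ intVec m) = 1 := by
  have : intVec k ⬝ᵥ intVec m = ((k ⬝ᵥ m : ℤ) : ℝ) := by
    simp [intVec, dotProduct]
  rw [this, expChar_int]

lemma mFourier_coe_eq_expChar (k : d → ℤ) (x : d → ℝ) :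
    UnitAddTorus.mFourier k (fun i => (x i : UnitAddCircle)) = expChar (intVec k ⬝ᵥ x) := by
  simp only [UnitAddTorus.mFourier, ContinuousMap.coe_mk, fourier_coe_apply]
  rw [expChar_eq, ← Complex.exp_sum]
  congr 1
  simp only [dotProduct, intVec]
  push_cast
  rw [Finset.mul_sum]
  exact Finset.sum_congr rfl fun i _ => by ring

/-- Half-open unit cubes with lattice corners. -/
def unitCube (m : d → ℤ) : Set (d → ℝ) := {x | ∀ i, x i ∈ Set.Ioc (m i : ℝ) (m i + 1)}

omit [Fintype d] in
lemma mem_unitCube_iff {m : d → ℤ} {x : d → ℝ} : x ∈ unitCube m ↔ ∀ i, ⌈x i⌉ - 1 = m i := by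
  simp only [unitCube, Set.mem_ofPred_eq, Set.mem_Ioc]
  refine forall_congr' fun i => ?_
  rw [sub_eq_iff_eq_add, Int.ceil_eq_iff]
  push_cast
  simp

lemma measurableSet_unitCube (m : d → ℤ) : MeasurableSet (unitCube m) :=
  MeasurableSet.univ_pi' fun _ => measurableSet_Ioc

omit [Fintype d] in
lemma pairwise_disjoint_unitCube :
    Pairwise (Function.onFun Disjoint (unitCube : (d → ℤ) → Set (d → ℝ))) := by
  intro m k hmk
  rw [Function.onFun, Set.disjoint_left]
  intro x hx hx'
  rw [mem_unitCube_iff] at hx hx'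
  exact hmk (funext fun i => (hx i).symm.trans (hx' i))

omit [Fintype d] in
lemma iUnion_unitCube : ⋃ m : d → ℤ, unitCube m = Set.univ := by
  ext x
  simp only [Set.mem_iUnion, Set.mem_univ, iff_true]
  exact ⟨fun i => ⌈x i⌉ - 1, mem_unitCube_iff.2 fun i => rfl⟩

lemma hasSum_setIntegral_unitCube {F : Type*} [NormedAddCommGroup F] [NormedSpace ℝ F]
    {h : (d → ℝ) → F} (hh : Integrable h) :
    HasSum (fun m : d → ℤ => ∫ x in unitCube 0, h (x - intVec m)) (∫ x, h x) := by
  have h1 : HasSum (fun m : d → ℤ => ∫ x in unitCube m, h x) (∫ x, h x) := by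
    have := hasSum_integral_iUnion (f := h) (μ := volume)
      (measurableSet_unitCube (d := d)) pairwise_disjoint_unitCube hh.integrableOn
    rwa [iUnion_unitCube, setIntegral_univ] at this
  have h2 := (Equiv.neg (d → ℤ)).hasSum_iff.2 h1
  refine h2.congr_fun ?_ 
  intro m
  simp only [Function.comp, Equiv.neg_apply]
  have hmp := measurePreserving_sub_right (volume : Measure (d → ℝ)) (intVec m)
  rw [← hmp.setIntegral_preimage_emb (MeasurableEquiv.subRight (intVec m)).measurableEmbedding h
    (unitCube (-m))]
  congr 2
  ext x
  simp only [unitCube, Set.mem_ofPred_eq, Set.mem_Ioc, Set.mem_preimage, Pi.sub_apply, intVec,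
    Pi.neg_apply, Pi.zero_apply]
  refine forall_congr' fun i => ?_
  push_cast
  constructor <;> rintro ⟨h1, h2⟩ <;> constructor <;> linarith

/-- Poisson summation for compactly supported continuous functions whose Fourier coefficients are
summable. -/
theorem hasSum_fourierCoeff_eq_latticeSum {h : (d → ℝ) → ℂ} (hc : Continuous h)
    (hs : HasCompactSupport h)
    (hsum : Summable fun k : d → ℤ => ∫ q, expChar (-(intVec k ⬝ᵥ q)) * h q) (x : d → ℝ) :
    HasSum (fun k : d → ℤ => (∫ q, expChar (-(intVec k ⬝ᵥ q)) * h q) * expChar (intVec k ⬝ᵥ x))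
      (latticeSum intVec (fun _ : d → ℤ => 1) h x) := by
  set K := latticeSum intVec (fun _ : d → ℤ => 1) h with hK
  have hKc : Continuous K := by
    rw [hK]
    exact continuous_latticeSum (tendsto_intVec (d := d)) hs hc (fun _ => 1)
  let π : (d → ℝ) → UnitAddTorus d := fun x i => (x i : UnitAddCircle)
  have hπ : IsOpenQuotientMap π :=
    IsOpenQuotientMap.piMap fun _ => QuotientAddGroup.isOpenQuotientMap_mk
  have hper : ∀ x y, π x = π y → K x = K y := by
    intro x y hxy
    have hz : ∀ i, ∃ m : ℤ, x i = y i + m := by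
      intro i
      have := congrFun hxy i
      simp only [π] at this
      rw [← sub_eq_zero, ← AddCircle.coe_sub, AddCircle.coe_eq_zero_iff] at this
      obtain ⟨m, hm⟩ := this
      exact ⟨m, by rw [zsmul_one] at hm; linarith⟩
    choose m hm using hz
    have hx : x = y + intVec m := funext hm
    simp only [hK, latticeSum, one_mul]
    rw [← (Equiv.addRight m).tsum_eq (fun k => h (x - intVec k))]
    refine tsum_congr fun k => ?_
    simp [hx, add_sub_add_right_eq_sub]
  let F : C(UnitAddTorus d, ℂ) :=
    ⟨fun t => K (Function.surjInv hπ.surjective t), by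
      rw [hπ.isQuotientMap.continuous_iff]
      refine hKc.congr fun x => hper _ _ ?_
      exact (Function.surjInv_eq hπ.surjective (π x)).symm⟩
  have hF : ∀ x, F (π x) = K x := fun x => hper _ _ (Function.surjInv_eq hπ.surjective (π x))
  have hcoef : ∀ k, UnitAddTorus.mFourierCoeff F k = ∫ q, expChar (-(intVec k ⬝ᵥ q)) * h q := by
    intro k
    rw [UnitAddTorus.mFourierCoeff_eq_integral F k 0]
    set g : (d → ℝ) → ℂ := fun q => expChar (-(intVec k ⬝ᵥ q)) * h q with hg
    have hgi : Integrable g := by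
      refine Continuous.integrable_of_hasCompactSupport (by fun_prop) hs.mul_left
    have h1 : ∀ x : d → ℝ, UnitAddTorus.mFourier (-k) (π x) • F (π x) =
        ∑' m : d → ℤ, g (x - intVec m) := by
      intro x
      rw [hF, smul_eq_mul]
      simp only [π]
      rw [mFourier_coe_eq_expChar]
      simp only [hK, latticeSum, one_mul, hg]
      rw [← tsum_mul_left]
      refine tsum_congr fun m => ?_
      congr 1
      rw [dotProduct_sub, neg_sub, sub_eq_neg_add, expChar_add, expChar_intVec_dotProduct]
      simp
    have hcube : {x : d → ℝ | ∀ i, x i ∈ Set.Ioc ((0 : d → ℝ) i) ((0 : d → ℝ) i + 1)} =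
        unitCube 0 := by
      simp [unitCube]
    rw [hcube]
    have h2 : ∀ x : d → ℝ, (UnitAddTorus.mFourier (-k) (fun i => (x i : UnitAddCircle))) •
      F (fun i => (x i : UnitAddCircle)) = ∑' m : d → ℤ, g (x - intVec m) := h1
    simp only [h2]
    rw [← integral_tsum_of_summable_integral_norm]
    · exact (hasSum_setIntegral_unitCube hgi).tsum_eq
    · intro m
      exact (hgi.comp_sub_right (intVec m)).integrableOn
    · exact (hasSum_setIntegral_unitCube hgi.norm).summable
  have hsum' : Summable (UnitAddTorus.mFourierCoeff F) := by
    simpa only [funext hcoef] using hsum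
  have := UnitAddTorus.hasSum_mFourier_series_apply_of_summable hsum' (π x)
  rw [hF] at this
  refine this.congr_fun fun k => ?_
  rw [hcoef, smul_eq_mul, ← mFourier_coe_eq_expChar]

end Poisson

open scoped Pointwise

section Coefficients

variable {d : Type*} [Fintype d]

/-- The dot product on `ℝ^d` as a continuous bilinear form. -/
noncomputable def dotCLM (d : Type*) [Fintype d] : (d → ℝ) →L[ℝ] (d → ℝ) →L[ℝ] ℝ :=
  LinearMap.toContinuousLinearMap
    ((LinearMap.toContinuousLinearMap : _ ≃ₗ[ℝ] ((d → ℝ) →L[ℝ] ℝ)).toLinearMap ∘ₗ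
      dotProductBilin ℝ ℝ)

lemma dotCLM_apply (x y : d → ℝ) : dotCLM d x y = x ⬝ᵥ y := rfl

lemma pow_norm_mul_norm_fourierIntegral_le {h : (d → ℝ) → ℂ} (hc : ContDiff ℝ (⊤ : ℕ∞) h)
    (hs : HasCompactSupport h) (N : ℕ) (w : d → ℝ) :
    (‖w‖ ^ N * ‖∫ q, expChar (-(w ⬝ᵥ q)) * h q‖) ≤
      2 ^ N * ∑ p ∈ Finset.range (N + 1), ∫ v, ‖iteratedFDeriv ℝ p h v‖ := by
  classical
  have hint : ∀ n : ℕ, Integrable (fun v => ‖iteratedFDeriv ℝ n h v‖) := fun n =>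
    ((hc.continuous_iteratedFDeriv (mod_cast le_top)).integrable_of_hasCompactSupport
      (hs.iteratedFDeriv n)).norm
  have hF : VectorFourier.fourierIntegral 𝐞 volume (dotCLM d).toLinearMap₁₂ h w =
      ∫ q, expChar (-(w ⬝ᵥ q)) * h q := by
    rw [VectorFourier.fourierIntegral]
    refine integral_congr_ae (Filter.Eventually.of_forall fun q => ?_)
    change 𝐞 (-(q ⬝ᵥ w)) • h q = _
    rw [Circle.smul_def, smul_eq_mul, dotProduct_comm]
    rfl
  have key : ∀ v : d → ℝ, ‖v‖ ≤ 1 → |v ⬝ᵥ w| ^ N * ‖∫ q, expChar (-(w ⬝ᵥ q)) * h q‖ ≤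
      2 ^ N * ∑ p ∈ Finset.range (N + 1), ∫ v, ‖iteratedFDeriv ℝ p h v‖ := by
    intro v hv
    have := VectorFourier.pow_mul_norm_iteratedFDeriv_fourierIntegral_le (dotCLM d) (μ := volume)
      (f := h) (K := 0) (N := ⊤) hc (fun k n hk _ => by
        have hk0 : k = 0 := by simpa using hk
        subst hk0
        simpa using hint n) (k := 0) (n := N) le_rfl le_top v w
    rw [norm_iteratedFDeriv_zero, hF, dotCLM_apply] at this
    refine this.trans ?_
    simp only [zero_add, Finset.range_one, CharP.cast_eq_zero, mul_zero, pow_zero, mul_one,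
      Finset.sum_product, Finset.sum_singleton, one_mul]
    have h0 : (0 : ℝ) ≤ ∑ p ∈ Finset.range (N + 1), ∫ v, ‖iteratedFDeriv ℝ p h v‖ :=
      Finset.sum_nonneg fun p _ => integral_nonneg fun v => norm_nonneg _
    have h1 : ‖v‖ ^ N ≤ 1 := pow_le_one₀ (norm_nonneg v) hv
    have h2 : ‖v‖ ^ N * 2 ^ N ≤ 1 * 2 ^ N := by gcongr
    rw [one_mul] at h2
    gcongr
  rcases isEmpty_or_nonempty d with hd | hd
  · have h0 : w = 0 := Subsingleton.elim _ _
    subst h0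
    simpa using key 0 (by simp)
  · obtain ⟨i, hi⟩ := Finite.exists_max fun i => ‖w i‖
    have hw : ‖w‖ = |w i| :=
      le_antisymm ((pi_norm_le_iff_of_nonneg (abs_nonneg _)).2 hi) (norm_le_pi_norm w i)
    have := key (Pi.single i 1) (by simp [Pi.norm_single])
    rwa [single_dotProduct, one_mul, ← hw] at this

/-- The Fourier coefficients of the periodization of `q ↦ Θ (q + y) * Ψ q`. -/
noncomputable def kernelCoeff (Θ Ψ : (d → ℝ) → ℂ) (z : (d → ℤ) × (d → ℝ)) : ℂ :=
  ∫ q, expChar (-(intVec z.1 ⬝ᵥ q)) * (Θ (q + z.2) * Ψ q)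

lemma exists_bound_integral_iteratedFDeriv_translate_mul {Θ Ψ : (d → ℝ) → ℂ}
    (hΘ : ContDiff ℝ (⊤ : ℕ∞) Θ) (hΘs : HasCompactSupport Θ)
    (hΨ : ContDiff ℝ (⊤ : ℕ∞) Ψ) (hΨs : HasCompactSupport Ψ) (p : ℕ) :
    ∃ C : ℝ, ∀ y, ∫ v, ‖iteratedFDeriv ℝ p (fun q => Θ (q + y) * Ψ q) v‖ ≤ C := by
  have hb : ∀ i : ℕ, ∃ M : ℝ, ∀ x, ‖iteratedFDeriv ℝ i Θ x‖ ≤ M := fun i =>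
    (hΘs.iteratedFDeriv i).exists_bound_of_continuous
      (hΘ.continuous_iteratedFDeriv (mod_cast le_top))
  choose M hM using hb
  have hint : ∀ n : ℕ, Integrable (fun v => ‖iteratedFDeriv ℝ n Ψ v‖) := fun n =>
    ((hΨ.continuous_iteratedFDeriv (mod_cast le_top)).integrable_of_hasCompactSupport
      (hΨs.iteratedFDeriv n)).norm
  set G : (d → ℝ) → ℝ := fun v => ∑ i ∈ Finset.range (p + 1),
    (p.choose i : ℝ) * M i * ‖iteratedFDeriv ℝ (p - i) Ψ v‖ with hG
  refine ⟨∫ v, G v, fun y => ?_⟩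
  have hsm : ContDiff ℝ (⊤ : ℕ∞) fun q => Θ (q + y) := by fun_prop
  refine integral_mono_of_nonneg (Filter.Eventually.of_forall fun v => norm_nonneg _)
    (integrable_finsetSum _ fun i _ => (hint _).const_mul _)
    (Filter.Eventually.of_forall fun v => ?_)
  refine (norm_iteratedFDeriv_mul_le (N := ((⊤ : ℕ∞) : WithTop ℕ∞)) hsm hΨ v
    (mod_cast le_top)).trans ?_
  refine Finset.sum_le_sum fun i _ => ?_
  have : ‖iteratedFDeriv ℝ i (fun q => Θ (q + y)) v‖ ≤ M i := by
    rw [iteratedFDeriv_comp_add_right]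
    exact hM i _
  gcongr

lemma summable_norm_intVec_inv_pow (d : Type*) [Fintype d] :
    ∃ N : ℕ, Summable fun k : d → ℤ => ‖intVec k‖⁻¹ ^ N := by
  classical
  let b := Pi.basisFun ℝ d
  let L := Submodule.span ℤ (Set.range b)
  obtain ⟨N, hN⟩ : ∃ N : ℕ, Summable fun z : L => ‖(z : d → ℝ)‖⁻¹ ^ N :=
    ⟨_, ZLattice.summable_norm_pow_inv L _ (Nat.lt_succ_self _)⟩
  refine ⟨N, ?_⟩
  have hmem : ∀ k : d → ℤ, intVec k ∈ L := by
    intro k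
    rw [show intVec k = ∑ i, k i • b i from ?_]
    · exact Submodule.sum_mem _ fun i _ =>
        Submodule.smul_mem _ _ (Submodule.subset_span ⟨i, rfl⟩)
    · ext j
      simp [b, intVec, Finset.sum_apply, Pi.single_apply]
  have hinj : Function.Injective fun k : d → ℤ => (⟨intVec k, hmem k⟩ : L) := by
    intro k m hkm
    have hv : intVec k = intVec m := congrArg Subtype.val hkm
    funext i
    exact Int.cast_injective (congrFun hv i)
  have hsum := hN.comp_injective hinj
  clear_value L
  exact hsum

lemma exists_summable_bound_kernelCoeff {Θ Ψ : (d → ℝ) → ℂ}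
    (hΘ : ContDiff ℝ (⊤ : ℕ∞) Θ) (hΘs : HasCompactSupport Θ)
    (hΨ : ContDiff ℝ (⊤ : ℕ∞) Ψ) (hΨs : HasCompactSupport Ψ) :
    ∃ w : (d → ℤ) → ℝ, Summable w ∧ ∀ k y, ‖kernelCoeff Θ Ψ (k, y)‖ ≤ w k := by
  classical
  have hpow : ∀ N : ℕ, ∃ C : ℝ, ∀ k y,
      ‖intVec k‖ ^ N * ‖kernelCoeff Θ Ψ (k, y)‖ ≤ C := by
    intro N
    choose C hC using exists_bound_integral_iteratedFDeriv_translate_mul hΘ hΘs hΨ hΨs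
    refine ⟨2 ^ N * ∑ p ∈ Finset.range (N + 1), C p, fun k y => ?_⟩
    refine (pow_norm_mul_norm_fourierIntegral_le (h := fun q => Θ (q + y) * Ψ q)
      (by fun_prop) hΨs.mul_left N (intVec k)).trans ?_
    gcongr with p
    exact hC p y
  obtain ⟨N, hN⟩ := summable_norm_intVec_inv_pow d
  obtain ⟨C₀, hC₀⟩ := hpow 0
  obtain ⟨C, hC⟩ := hpow N
  refine ⟨fun k => C * ‖intVec k‖⁻¹ ^ N + if k = 0 then |C₀| + |C * ‖intVec k‖⁻¹ ^ N| else 0,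
    (hN.mul_left C).add (summable_of_hasFiniteSupport ((Set.finite_singleton 0).subset ?_)), ?_⟩
  · intro k hk
    by_contra h
    simp_all
  · intro k y
    by_cases hk : k = 0
    · have h0 := hC₀ k y
      rw [pow_zero, one_mul] at h0
      simp only [if_pos hk]
      have := neg_abs_le (C * ‖intVec k‖⁻¹ ^ N)
      linarith [le_abs_self C₀]
    · have hpos : 0 < ‖intVec k‖ := by
        rw [norm_pos_iff]
        intro h
        apply hk
        funext i
        have := congrFun h i
        simpa [intVec] using this
      simp only [if_neg hk, add_zero]
      rw [inv_pow, ← div_eq_mul_inv, le_div_iff₀ (by positivity), mul_comm]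
      exact hC k y

lemma kernelCoeff_eq_zero {Θ Ψ : (d → ℝ) → ℂ} {z : (d → ℤ) × (d → ℝ)}
    (hz : z.2 ∉ tsupport Θ + -tsupport Ψ) : kernelCoeff Θ Ψ z = 0 := by
  rw [kernelCoeff]
  refine integral_eq_zero_of_ae (Filter.Eventually.of_forall fun q => ?_)
  by_contra hne
  have h1 : Θ (q + z.2) ≠ 0 := fun h => hne (by simp [h])
  have h2 : Ψ q ≠ 0 := fun h => hne (by simp [h])
  exact hz ⟨q + z.2, subset_tsupport _ h1, -q, Set.neg_mem_neg.2 (subset_tsupport _ h2), by simp⟩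

omit [Fintype d] in
@[fun_prop] lemma continuous_intVec : Continuous (intVec : (d → ℤ) → d → ℝ) := by
  unfold intVec
  fun_prop

lemma stronglyMeasurable_kernelCoeff {Θ Ψ : (d → ℝ) → ℂ} (hΘ : Continuous Θ)
    (hΨ : Continuous Ψ) : StronglyMeasurable (kernelCoeff Θ Ψ) := by
  have hc : Continuous fun p : ((d → ℤ) × (d → ℝ)) × (d → ℝ) =>
      expChar (-(intVec p.1.1 ⬝ᵥ p.2)) * (Θ (p.2 + p.1.2) * Ψ p.2) := by
    fun_prop
  exact hc.stronglyMeasurable.integral_prod_right'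

lemma integrable_kernelCoeff {Θ Ψ : (d → ℝ) → ℂ}
    (hΘ : ContDiff ℝ (⊤ : ℕ∞) Θ) (hΘs : HasCompactSupport Θ)
    (hΨ : ContDiff ℝ (⊤ : ℕ∞) Ψ) (hΨs : HasCompactSupport Ψ) :
    Integrable (kernelCoeff Θ Ψ) (Measure.count.prod volume) := by
  obtain ⟨w, hw, hle⟩ := exists_summable_bound_kernelCoeff hΘ hΘs hΨ hΨs
  have hB : IsCompact (tsupport Θ + -tsupport Ψ) := IsCompact.add hΘs (IsCompact.neg hΨs)
  have h1 : Integrable w Measure.count := integrable_count_iff.2 hw.norm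
  have h2 : Integrable ((tsupport Θ + -tsupport Ψ).indicator fun _ => (1 : ℝ)) :=
    (integrable_indicator_iff hB.measurableSet).2 (integrableOn_const hB.measure_lt_top.ne)
  refine (h1.mul_prod h2).mono'
    (stronglyMeasurable_kernelCoeff hΘ.continuous hΨ.continuous).aestronglyMeasurable
    (Filter.Eventually.of_forall fun z => ?_)
  by_cases hz : z.2 ∈ tsupport Θ + -tsupport Ψ
  · simpa [Set.indicator_of_mem hz] using hle z.1 z.2
  · simp [kernelCoeff_eq_zero hz, Set.indicator_of_notMem hz]

end Coefficients

section Representation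

variable {d : Type*} [Fintype d]

lemma integral_mul_latticeSum_translate {Θ Φ : (d → ℝ) → ℂ} (hΘ : Continuous Θ)
    (hΘs : HasCompactSupport Θ) (hΦ : Continuous Φ) (hΦs : HasCompactSupport Φ)
    (hA : ∀ α : d → ℤ, (∫ x, Θ x * Φ (x - intVec α)) = if α = 0 then 1 else 0)
    (A : (d → ℤ) → ℂ) (m : d → ℤ) :
    ∫ y, Θ y * latticeSum intVec A Φ (y + intVec m) = A m := by
  classical
  have hB : IsCompact ((fun y => y + intVec m) '' tsupport Θ) :=
    IsCompact.image hΘs (by fun_prop)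
  obtain ⟨S, hS⟩ := exists_finset_translate_eq_zero (tendsto_intVec (d := d)) hΦs hB
  have h1 : ∀ y, Θ y * latticeSum intVec A Φ (y + intVec m) =
      ∑ k ∈ insert m S, A k * (Θ y * Φ (y - intVec (k - m))) := by
    intro y
    have hsub : ∀ k : d → ℤ, y + intVec m - intVec k = y - intVec (k - m) := by
      intro k
      rw [sub_eq_add_neg k, intVec_add, intVec_neg]
      abel
    by_cases hy : y ∈ tsupport Θ
    · rw [latticeSum, tsum_eq_sum (s := insert m S), Finset.mul_sum]
      · refine Finset.sum_congr rfl fun k _ => ?_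
        rw [hsub]
        ring
      · intro k hk
        rw [hS _ ⟨y, hy, rfl⟩ k fun h => hk (Finset.mem_insert_of_mem h), mul_zero]
    · simp [image_eq_zero_of_notMem_tsupport hy]
  simp only [h1]
  rw [integral_finsetSum]
  · simp only [integral_const_mul, hA, sub_eq_zero, mul_ite, mul_one, mul_zero]
    simp
  · intro k _
    refine Integrable.const_mul ?_ _
    exact Continuous.integrable_of_hasCompactSupport (by fun_prop) hΘs.mul_right

lemma exists_norm_latticeSum_le {Φ : (d → ℝ) → ℂ} (hΦ : Continuous Φ)
    (hΦs : HasCompactSupport Φ) {A : (d → ℤ) → ℂ} (hA : ∃ C : ℝ, ∀ m, ‖A m‖ ≤ C) :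
    ∃ C : ℝ, ∀ x, ‖latticeSum intVec A Φ x‖ ≤ C := by
  obtain ⟨C, hC⟩ := hA
  obtain ⟨M, hM⟩ := hΦs.exists_bound_of_continuous hΦ
  obtain ⟨S, hS⟩ := exists_finset_latticeSum_eq (tendsto_intVec (d := d)) hΦs
    (isCompact_closedBall (0 : d → ℝ) 1)
  refine ⟨∑ m ∈ S, C * M, fun x => ?_⟩
  let k : d → ℤ := fun i => ⌊x i⌋
  have hper : latticeSum intVec A Φ x =
      latticeSum intVec (fun m => A (m + k)) Φ (x - intVec k) := by
    rw [latticeSum, latticeSum, ← (Equiv.addRight k).tsum_eq]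
    refine tsum_congr fun m => ?_
    simp [sub_add_eq_sub_sub_swap]
  have hmem : x - intVec k ∈ Metric.closedBall (0 : d → ℝ) 1 := by
    rw [mem_closedBall_zero_iff, pi_norm_le_iff_of_nonneg zero_le_one]
    intro i
    simp only [Pi.sub_apply, intVec, k, Int.self_sub_floor, Real.norm_eq_abs, Int.abs_fract]
    exact (Int.fract_lt_one _).le
  rw [hper, hS _ _ hmem]
  refine (norm_sum_le _ _).trans (Finset.sum_le_sum fun m _ => ?_)
  rw [norm_mul]
  exact mul_le_mul (hC _) (hM _) (norm_nonneg _) ((norm_nonneg _).trans (hC 0))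

/-- A lattice sum of translates of `Ψ` is an absolutely convergent superposition of modulated
translates of the lattice sum for any `Φ` that admits a dual function `Θ`. -/
theorem latticeSum_eq_integral_kernelCoeff {Θ Φ Ψ : (d → ℝ) → ℂ}
    (hΘ : ContDiff ℝ (⊤ : ℕ∞) Θ) (hΘs : HasCompactSupport Θ)
    (hΦ : Continuous Φ) (hΦs : HasCompactSupport Φ)
    (hΨ : ContDiff ℝ (⊤ : ℕ∞) Ψ) (hΨs : HasCompactSupport Ψ)
    (hdual : ∀ α : d → ℤ, (∫ x, Θ x * Φ (x - intVec α)) = if α = 0 then 1 else 0)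
    {A : (d → ℤ) → ℂ} (hA : ∃ C : ℝ, ∀ m, ‖A m‖ ≤ C) (u : d → ℝ) :
    latticeSum intVec A Ψ u =
      ∫ z, kernelCoeff Θ Ψ z * (expChar (intVec z.1 ⬝ᵥ u) * latticeSum intVec A Φ (u + z.2))
        ∂(Measure.count.prod volume) := by
  set σ := latticeSum intVec A Φ with hσ
  have hσc : Continuous σ := by
    rw [hσ]
    exact continuous_latticeSum (tendsto_intVec (d := d)) hΦs hΦ A
  obtain ⟨C, hC⟩ := exists_norm_latticeSum_le hΦ hΦs hA
  have hint : Integrable (fun z : (d → ℤ) × (d → ℝ) => kernelCoeff Θ Ψ z *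
      (expChar (intVec z.1 ⬝ᵥ u) * σ (u + z.2))) (Measure.count.prod volume) := by
    refine (integrable_kernelCoeff hΘ hΘs hΨ hΨs).mul_bdd (c := C)
      (Continuous.aestronglyMeasurable (by fun_prop)) (Filter.Eventually.of_forall fun z => ?_)
    rw [norm_mul, norm_expChar, one_mul]
    exact hC _
  rw [integral_prod_symm _ hint]
  obtain ⟨w, hw, hle⟩ := exists_summable_bound_kernelCoeff hΘ hΘs hΨ hΨs
  obtain ⟨S, hS⟩ := exists_finset_translate_eq_zero (tendsto_intVec (d := d)) hΨs
    (isCompact_singleton (x := u))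
  have hinner : ∀ y : d → ℝ, ∫ k : d → ℤ, kernelCoeff Θ Ψ (k, y) *
      (expChar (intVec k ⬝ᵥ u) * σ (u + y)) ∂Measure.count =
      ∑ m ∈ S, Ψ (u - intVec m) * (Θ (u - intVec m + y) * σ (u + y)) := by
    intro y
    have hsum : Summable fun k : d → ℤ => kernelCoeff Θ Ψ (k, y) :=
      Summable.of_norm_bounded hw fun k => hle k y
    have hP := hasSum_fourierCoeff_eq_latticeSum (h := fun q => Θ (q + y) * Ψ q)
      (by have := hΘ.continuous; have := hΨ.continuous; fun_prop) hΨs.mul_left hsum u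
    have hI : Integrable (fun k : d → ℤ => kernelCoeff Θ Ψ (k, y) *
        (expChar (intVec k ⬝ᵥ u) * σ (u + y))) Measure.count := by
      rw [integrable_count_iff]
      refine Summable.of_nonneg_of_le (fun k => norm_nonneg _) (fun k => ?_) (hw.mul_right C)
      rw [norm_mul, norm_mul, norm_expChar, one_mul]
      exact mul_le_mul (hle k y) (hC _) (norm_nonneg _) ((norm_nonneg _).trans (hle k y))
    rw [integral_countable hI]
    have hreal : ∀ k : d → ℤ, (Measure.count : Measure (d → ℤ)).real {k} = 1 := by
      intro k
      simp [measureReal_def]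
    simp only [hreal, one_smul]
    have hP' : HasSum (fun k : d → ℤ => kernelCoeff Θ Ψ (k, y) *
        (expChar (intVec k ⬝ᵥ u) * σ (u + y)))
        (latticeSum intVec (fun _ : d → ℤ => 1) (fun q => Θ (q + y) * Ψ q) u * σ (u + y)) :=
      (hP.mul_right (σ (u + y))).congr_fun fun k => (mul_assoc _ _ _).symm
    rw [hP'.tsum_eq]
    rw [latticeSum, tsum_eq_sum (s := S) fun m hm => by
      rw [hS u rfl m hm]; simp, Finset.sum_mul]
    exact Finset.sum_congr rfl fun m _ => by ring
  simp only [hinner]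
  rw [integral_finsetSum]
  · rw [latticeSum, tsum_eq_sum (s := S) fun m hm => by rw [hS u rfl m hm]; simp]
    refine Finset.sum_congr rfl fun m _ => ?_
    rw [integral_const_mul, mul_comm]
    congr 1
    rw [← integral_mul_latticeSum_translate hΘ.continuous hΘs hΦ hΦs hdual A m, ← hσ,
      ← integral_add_left_eq_self _ (u - intVec m)]
    refine integral_congr_ae (Filter.Eventually.of_forall fun y => ?_)
    simp only
    congr 2
    abel
  · intro m _
    refine Integrable.const_mul ?_ _
    refine Continuous.integrable_of_hasCompactSupport
      (by have := hΘ.continuous; fun_prop) (HasCompactSupport.mul_right ?_)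
    exact hΘs.comp_homeomorph (Homeomorph.addLeft (u - intVec m))

end Representation

lemma iteratedDeriv_expChar (n : ℕ) :
    iteratedDeriv n expChar = fun t => (2 * Real.pi * Complex.I) ^ n * expChar t := by
  induction n with
  | zero => simp
  | succ n ih =>
    rw [iteratedDeriv_succ, ih]
    funext t
    have h : HasDerivAt expChar (2 * Real.pi * Complex.I * expChar t) t := by
      have h1 : HasDerivAt (fun s : ℝ => Complex.exp (2 * Real.pi * Complex.I * s))
          (Complex.exp (2 * Real.pi * Complex.I * t) * (2 * Real.pi * Complex.I * 1)) t :=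
        ((Complex.ofRealCLM.hasDerivAt (x := t)).const_mul _).cexp
      rw [funext expChar_eq]
      convert h1 using 1
      ring
    rw [(h.const_mul _).deriv, pow_succ]
    ring

lemma contDiff_expChar : ContDiff ℝ (⊤ : ℕ∞) expChar := by
  rw [funext expChar_eq]
  exact (contDiff_const.mul Complex.ofRealCLM.contDiff).cexp

@[fun_prop] lemma hasTemperateGrowth_expChar : Function.HasTemperateGrowth expChar := by
  refine ⟨contDiff_expChar, fun n => ⟨0, ‖2 * Real.pi * Complex.I‖ ^ n, fun t => ?_⟩⟩
  rw [norm_iteratedFDeriv_eq_norm_iteratedDeriv, iteratedDeriv_expChar]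
  simp

section SchwartzFourier

variable {n : ℕ}

lemma hasTemperateGrowth_expChar_dotProduct (y : Rn n) :
    Function.HasTemperateGrowth fun x : Rn n => expChar (y ⬝ᵥ x) :=
  hasTemperateGrowth_expChar.comp (dotCLM (Fin n) y).hasTemperateGrowth

/-- The Schwartz function `x ↦ e^{2πi y·x} f(x + a)`. -/
noncomputable def modTranslate (a y : Rn n) (f : SchwartzMap (Rn n) ℂ) : SchwartzMap (Rn n) ℂ :=
  SchwartzMap.smulLeftCLM ℂ (fun x => expChar (y ⬝ᵥ x)) (f.compSubConstCLM ℂ (-a))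

lemma modTranslate_apply (a y : Rn n) (f : SchwartzMap (Rn n) ℂ) (x : Rn n) :
    modTranslate a y f x = expChar (y ⬝ᵥ x) * f (x + a) := by
  simp [modTranslate, hasTemperateGrowth_expChar_dotProduct y]

lemma eLpNorm_modTranslate (a y : Rn n) (f : SchwartzMap (Rn n) ℂ) (p : ℝ≥0∞) :
    eLpNorm (modTranslate a y f) p volume = eLpNorm f p volume := by
  rw [← eLpNorm_comp_measurePreserving f.continuous.aestronglyMeasurable
    (measurePreserving_add_right volume a)]
  exact eLpNorm_congr_norm_ae (Filter.Eventually.of_forall fun x => by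
    simp [modTranslate_apply])

lemma ft_eq (f : SchwartzMap (Rn n) ℂ) (ξ : Rn n) :
    ft f ξ = ∫ x, expChar (-(x ⬝ᵥ ξ)) * f x := by
  refine integral_congr_ae (Filter.Eventually.of_forall fun x => ?_)
  simp only [expChar_eq, dotProduct]
  congr 2
  push_cast
  ring

lemma ft_modTranslate (a y : Rn n) (f : SchwartzMap (Rn n) ℂ) (ξ : Rn n) :
    ft (modTranslate a y f) ξ = expChar (a ⬝ᵥ (ξ - y)) * ft f (ξ - y) := by
  rw [ft_eq, ft_eq, ← integral_const_mul,
    ← integral_add_right_eq_self (fun x => expChar (a ⬝ᵥ (ξ - y)) *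
      (expChar (-(x ⬝ᵥ (ξ - y))) * f x)) a]
  refine integral_congr_ae (Filter.Eventually.of_forall fun x => ?_)
  simp only [modTranslate_apply, ← mul_assoc, ← expChar_add]
  congr 2
  rw [add_dotProduct, dotProduct_comm y x, dotProduct_sub x]
  ring

/-- The Schwartz function on Euclidean space whose value at `x` is `f x`. -/
noncomputable def schwartzToEuclidean (f : SchwartzMap (Rn n) ℂ) :
    SchwartzMap (EuclideanSpace ℝ (Fin n)) ℂ :=
  SchwartzMap.compCLMOfContinuousLinearEquiv ℂ (EuclideanSpace.equiv (Fin n) ℝ) f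

lemma fourier_schwartzToEuclidean (f : SchwartzMap (Rn n) ℂ) (ξ : Rn n) :
    𝓕 (schwartzToEuclidean f) (WithLp.toLp 2 ξ) = ft f ξ := by
  rw [ft_eq, SchwartzMap.fourier_coe, Real.fourier_eq,
    ← (PiLp.volume_preserving_toLp (Fin n)).integral_comp
      (MeasurableEquiv.toLp 2 (Fin n → ℝ)).measurableEmbedding]
  refine integral_congr_ae (Filter.Eventually.of_forall fun x => ?_)
  simp only [Circle.smul_def, smul_eq_mul, EuclideanSpace.inner_toLp_toLp, star_trivial]
  rw [dotProduct_comm]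
  rfl

lemma continuous_ft (f : SchwartzMap (Rn n) ℂ) : Continuous (ft f) := by
  rw [← funext (fourier_schwartzToEuclidean f)]
  exact (𝓕 (schwartzToEuclidean f)).continuous.comp (PiLp.continuous_toLp 2 _)

lemma integrable_ft (f : SchwartzMap (Rn n) ℂ) : Integrable (ft f) := by
  rw [← funext (fourier_schwartzToEuclidean f)]
  exact (PiLp.volume_preserving_toLp (Fin n)).integrable_comp_of_integrable
    (𝓕 (schwartzToEuclidean f)).integrable

end SchwartzFourier

section Minkowski

variable {X Z : Type*} [MeasurableSpace X] [MeasurableSpace Z] {μ : Measure X} {κ : Measure Z}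

lemma sq_lintegral_mul_le {w h : Z → ℝ≥0∞} (hw : Measurable w) (hh : Measurable h) :
    (∫⁻ z, w z * h z ∂κ) ^ 2 ≤ (∫⁻ z, w z ∂κ) * ∫⁻ z, w z * h z ^ 2 ∂κ := by
  have key := ENNReal.lintegral_mul_le_Lp_mul_Lq κ Real.HolderConjugate.two_two
    (f := fun z => w z ^ (1 / 2 : ℝ)) (g := fun z => w z ^ (1 / 2 : ℝ) * h z)
    (by fun_prop) (by fun_prop)
  have hsqrt : ∀ t : ℝ≥0∞, (t ^ (1 / 2 : ℝ)) ^ (2 : ℝ) = t := fun t => by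
    rw [← ENNReal.rpow_mul]; norm_num
  have hmul : ∀ z, ((fun z => w z ^ (1 / 2 : ℝ)) * fun z => w z ^ (1 / 2 : ℝ) * h z) z =
      w z * h z := fun z => by
    rw [Pi.mul_apply, ← mul_assoc, ← ENNReal.rpow_add_of_nonneg _ _ (by norm_num) (by norm_num)]
    norm_num
  simp only [hmul, ENNReal.mul_rpow_of_nonneg _ _ zero_le_two, hsqrt, ENNReal.rpow_two] at key
  calc (∫⁻ z, w z * h z ∂κ) ^ 2
      ≤ ((∫⁻ z, w z ∂κ) ^ (1 / 2 : ℝ) * (∫⁻ z, w z * h z ^ 2 ∂κ) ^ (1 / 2 : ℝ)) ^ 2 := by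
        gcongr
    _ = _ := by
        rw [mul_pow, ← ENNReal.rpow_two, ← ENNReal.rpow_two, hsqrt, hsqrt]

lemma lintegral_sq_lintegral_mul_le [SFinite μ] [SFinite κ] {w : Z → ℝ≥0∞} {h : Z → X → ℝ≥0∞}
    (hw : Measurable w) (hh : Measurable (Function.uncurry h)) {B : ℝ≥0∞}
    (hB : ∀ z, ∫⁻ x, h z x ^ 2 ∂μ ≤ B) :
    ∫⁻ x, (∫⁻ z, w z * h z x ∂κ) ^ 2 ∂μ ≤ (∫⁻ z, w z ∂κ) ^ 2 * B := by
  have hh1 : ∀ z, Measurable (h z) := fun z => hh.comp measurable_prodMk_left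
  have hh2 : ∀ x, Measurable fun z => h z x := fun x => hh.comp measurable_prodMk_right
  have hm : Measurable (Function.uncurry fun x z => w z * h z x ^ 2) :=
    (hw.comp measurable_snd).mul ((hh.comp measurable_swap).pow_const 2)
  calc ∫⁻ x, (∫⁻ z, w z * h z x ∂κ) ^ 2 ∂μ
      ≤ ∫⁻ x, (∫⁻ z, w z ∂κ) * ∫⁻ z, w z * h z x ^ 2 ∂κ ∂μ :=
        lintegral_mono fun x => sq_lintegral_mul_le hw (hh2 x)
    _ = (∫⁻ z, w z ∂κ) * ∫⁻ z, w z * ∫⁻ x, h z x ^ 2 ∂μ ∂κ := by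
        rw [lintegral_const_mul _ hm.lintegral_prod_right, lintegral_lintegral_swap hm.aemeasurable]
        congr 1
        exact lintegral_congr fun z => lintegral_const_mul _ ((hh1 z).pow_const 2)
    _ ≤ (∫⁻ z, w z ∂κ) * ∫⁻ z, w z * B ∂κ := by
        gcongr with z
        exact hB z
    _ = _ := by rw [lintegral_mul_const _ hw]; ring

end Minkowski

section Averages

variable {n : ℕ}

lemma Tbil_eq (σ : Rn n × Rn n → ℂ) (f g : SchwartzMap (Rn n) ℂ) (x : Rn n) :
    Tbil σ f g x =
      ∫ p : Rn n × Rn n, expChar (x ⬝ᵥ (p.1 + p.2)) * σ p * ft f p.1 * ft g p.2 := by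
  simp only [Tbil, expChar_eq, dotProduct, Pi.add_apply]

lemma Tbil_modTranslate (σ : Rn n × Rn n → ℂ) (f g : SchwartzMap (Rn n) ℂ)
    (a y : Rn n × Rn n) (x : Rn n) :
    Tbil σ (modTranslate a.1 y.1 f) (modTranslate a.2 y.2 g) x =
      expChar (x ⬝ᵥ (y.1 + y.2)) * ∫ p : Rn n × Rn n, expChar (x ⬝ᵥ (p.1 + p.2)) *
        (expChar (a.1 ⬝ᵥ p.1 + a.2 ⬝ᵥ p.2) * σ (p + y)) * ft f p.1 * ft g p.2 := by
  have : (volume : Measure (Rn n × Rn n)).IsAddRightInvariant :=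
    inferInstanceAs (Measure.prod volume volume).IsAddRightInvariant
  rw [Tbil_eq, ← integral_const_mul, ← integral_add_right_eq_self _ y]
  refine integral_congr_ae (Filter.Eventually.of_forall fun p => ?_)
  simp only [ft_modTranslate, Prod.fst_add, Prod.snd_add, add_sub_cancel_right, expChar_add,
    dotProduct_add]
  ring

variable {Z : Type*} [MeasurableSpace Z] {κ : Measure Z} [SFinite κ]

lemma Tbil_integral {σ τ : Rn n × Rn n → ℂ} {c : Z → ℂ} {a y : Z → Rn n × Rn n}
    (hc : Integrable c κ) (hcm : Measurable c) (ha : Measurable a) (hy : Measurable y)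
    (hσ : Continuous σ) (hσb : ∃ C, ∀ p, ‖σ p‖ ≤ C)
    (hτ : ∀ p, τ p =
      ∫ z, c z * (expChar ((a z).1 ⬝ᵥ p.1 + (a z).2 ⬝ᵥ p.2) * σ (p + y z)) ∂κ)
    (f g : SchwartzMap (Rn n) ℂ) (x : Rn n) :
    Tbil τ f g x = ∫ z, c z * (expChar (-(x ⬝ᵥ ((y z).1 + (y z).2))) *
      Tbil σ (modTranslate (a z).1 (y z).1 f) (modTranslate (a z).2 (y z).2 g) x) ∂κ := by
  obtain ⟨C, hC⟩ := hσb
  have hint : Integrable (Function.uncurry fun (p : Rn n × Rn n) (z : Z) =>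
      expChar (x ⬝ᵥ (p.1 + p.2)) *
        (c z * (expChar ((a z).1 ⬝ᵥ p.1 + (a z).2 ⬝ᵥ p.2) * σ (p + y z))) *
        ft f p.1 * ft g p.2) (volume.prod κ) := by
    refine ((((integrable_ft f).mul_prod (integrable_ft g)).norm.mul_prod
      hc.norm).mul_const C).mono' ?_ (Filter.Eventually.of_forall fun q => ?_)
    · have h1 := (continuous_ft f).measurable
      have h2 := (continuous_ft g).measurable
      have h3 := hσ.measurable
      have h4 := continuous_expChar.measurable
      refine Measurable.aestronglyMeasurable ?_
      simp only [Function.uncurry_def, dotProduct, Pi.add_apply]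
      fun_prop
    · simp only [Function.uncurry, norm_mul, norm_expChar, one_mul]
      have := hC (q.1 + y q.2)
      calc ‖c q.2‖ * ‖σ (q.1 + y q.2)‖ * ‖ft f q.1.1‖ * ‖ft g q.1.2‖
          ≤ ‖c q.2‖ * C * ‖ft f q.1.1‖ * ‖ft g q.1.2‖ := by gcongr
        _ = _ := by ring
  calc Tbil τ f g x
      = ∫ p : Rn n × Rn n, ∫ z, expChar (x ⬝ᵥ (p.1 + p.2)) *
        (c z * (expChar ((a z).1 ⬝ᵥ p.1 + (a z).2 ⬝ᵥ p.2) * σ (p + y z))) *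
        ft f p.1 * ft g p.2 ∂κ := by
        rw [Tbil_eq]
        refine integral_congr_ae (Filter.Eventually.of_forall fun p => ?_)
        simp only [hτ, integral_const_mul, integral_mul_const]
    _ = _ := by
        rw [integral_integral_swap hint]
        refine integral_congr_ae (Filter.Eventually.of_forall fun z => ?_)
        simp only [Tbil_modTranslate]
        rw [← mul_assoc (expChar _), ← expChar_add, neg_add_cancel, expChar_zero, one_mul,
          ← integral_const_mul]
        refine integral_congr_ae (Filter.Eventually.of_forall fun p => ?_)
        simp only
        ring

lemma measurable_Tbil_modTranslate {σ : Rn n × Rn n → ℂ} {a y : Z → Rn n × Rn n}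
    (ha : Measurable a) (hy : Measurable y) (hσ : Continuous σ) (f g : SchwartzMap (Rn n) ℂ) :
    Measurable fun q : Z × Rn n =>
      Tbil σ (modTranslate (a q.1).1 (y q.1).1 f) (modTranslate (a q.1).2 (y q.1).2 g) q.2 := by
  have h1 := (continuous_ft f).measurable
  have h2 := (continuous_ft g).measurable
  have h3 := hσ.measurable
  have h4 := continuous_expChar.measurable
  simp only [Tbil_modTranslate]
  refine Measurable.mul (by simp only [dotProduct, Pi.add_apply]; fun_prop) ?_
  refine (StronglyMeasurable.integral_prod_right'
    (f := fun r : (Z × Rn n) × (Rn n × Rn n) => expChar (r.1.2 ⬝ᵥ (r.2.1 + r.2.2)) *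
        (expChar ((a r.1.1).1 ⬝ᵥ r.2.1 + (a r.1.1).2 ⬝ᵥ r.2.2) * σ (r.2 + y r.1.1)) *
        ft f r.2.1 * ft g r.2.2) ?_).measurable
  refine Measurable.stronglyMeasurable ?_
  simp only [dotProduct, Pi.add_apply]
  fun_prop

lemma localL2_le_multNorm_top (σ : Rn n × Rn n → ℂ) {f g : SchwartzMap (Rn n) ℂ}
    (hf : eLpNorm f 2 volume = 1) (hg : eLpNorm g 2 volume = 1) (ν : Zn n) :
    localL2 (Tbil σ f g) ν ≤ multNorm ⊤ σ := by
  refine le_trans ?_ (le_iSup₂_of_le f g (le_iSup₂_of_le hf hg le_rfl))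
  rw [amalgamNorm, if_pos rfl]
  exact le_iSup (fun ν => localL2 (Tbil σ f g) ν) ν

/-- A superposition of modulations and translations of a symbol is a multiplier, with norm at most
the total mass of the weight times the norm of the symbol. -/
lemma multNorm_top_le_of_integral {σ τ : Rn n × Rn n → ℂ} {c : Z → ℂ} {a y : Z → Rn n × Rn n}
    (hc : Integrable c κ) (hcm : Measurable c) (ha : Measurable a) (hy : Measurable y)
    (hσ : Continuous σ) (hσb : ∃ C, ∀ p, ‖σ p‖ ≤ C)
    (hτ : ∀ p, τ p =
      ∫ z, c z * (expChar ((a z).1 ⬝ᵥ p.1 + (a z).2 ⬝ᵥ p.2) * σ (p + y z)) ∂κ) :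
    multNorm ⊤ τ ≤ (∫⁻ z, ‖c z‖ₑ ∂κ) * multNorm ⊤ σ := by
  refine iSup₂_le fun f g => iSup₂_le fun hf hg => ?_
  rw [amalgamNorm, if_pos rfl]
  refine iSup_le fun ν => ?_
  set F : Z → Rn n → ℂ := fun z =>
    Tbil σ (modTranslate (a z).1 (y z).1 f) (modTranslate (a z).2 (y z).2 g) with hF
  have hsqrt : ∀ t : ℝ≥0∞, (t ^ 2) ^ (1 / 2 : ℝ) = t := fun t => by
    rw [← ENNReal.rpow_two, ← ENNReal.rpow_mul]; norm_num
  have hsq : ∀ t : ℝ≥0∞, (t ^ (1 / 2 : ℝ)) ^ 2 = t := fun t => by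
    rw [← ENNReal.rpow_two, ← ENNReal.rpow_mul]; norm_num
  have hpt : ∀ x, (‖Tbil τ f g x‖₊ : ℝ≥0∞) ≤ ∫⁻ z, ‖c z‖ₑ * ‖F z x‖ₑ ∂κ := fun x => by
    rw [Tbil_integral hc hcm ha hy hσ hσb hτ]
    refine (enorm_integral_le_lintegral_enorm _).trans (lintegral_mono fun z => ?_)
    rw [enorm_mul, enorm_mul, ← ofReal_norm (expChar _), norm_expChar, ENNReal.ofReal_one, one_mul]
  have hB : ∀ z, ∫⁻ x in cube n 1, ‖F z (x + coeZ ν)‖ₑ ^ 2 ≤ multNorm ⊤ σ ^ 2 := fun z => by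
    have h := localL2_le_multNorm_top σ (f := modTranslate (a z).1 (y z).1 f)
      (g := modTranslate (a z).2 (y z).2 g) (by rwa [eLpNorm_modTranslate])
      (by rwa [eLpNorm_modTranslate]) ν
    calc _ = (localL2 (F z) ν) ^ 2 := (hsq _).symm
      _ ≤ _ := by gcongr
  have hFm : Measurable (Function.uncurry fun z x => ‖F z (x + coeZ ν)‖ₑ) :=
    ((measurable_Tbil_modTranslate ha hy hσ f g).comp
      (measurable_fst.prodMk (measurable_snd.add_const (coeZ ν)))).enorm
  calc localL2 (Tbil τ f g) ν
      ≤ (∫⁻ x in cube n 1, (∫⁻ z, ‖c z‖ₑ * ‖F z (x + coeZ ν)‖ₑ ∂κ) ^ 2) ^ (1 / 2 : ℝ) := by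
        unfold localL2
        gcongr with x
        exact hpt _
    _ ≤ ((∫⁻ z, ‖c z‖ₑ ∂κ) ^ 2 * multNorm ⊤ σ ^ 2) ^ (1 / 2 : ℝ) := by
        gcongr
        exact lintegral_sq_lintegral_mul_le hcm.enorm hFm hB
    _ = _ := by rw [← mul_pow, hsqrt]

end Averages

section Splitting

variable {n : ℕ}

/-- The identification of functions on a disjoint union with pairs of functions. -/
noncomputable def sumEquiv (n : ℕ) : (Fin n ⊕ Fin n → ℝ) ≃L[ℝ] Rn n × Rn n :=
  ContinuousLinearEquiv.sumPiEquivProdPi ℝ (Fin n) (Fin n) fun _ => ℝ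

lemma sumEquiv_apply (u : Fin n ⊕ Fin n → ℝ) :
    sumEquiv n u = (fun i => u (Sum.inl i), fun i => u (Sum.inr i)) := rfl

lemma measurePreserving_sumEquiv (n : ℕ) : MeasurePreserving (sumEquiv n) :=
  volume_measurePreserving_sumPiEquivProdPi fun _ : Fin n ⊕ Fin n => ℝ

lemma sumEquiv_dotProduct (u v : Fin n ⊕ Fin n → ℝ) :
    (sumEquiv n u).1 ⬝ᵥ (sumEquiv n v).1 + (sumEquiv n u).2 ⬝ᵥ (sumEquiv n v).2 = u ⬝ᵥ v := by
  simp [sumEquiv_apply, dotProduct]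

/-- A matrix indexed by pairs of lattice points, as a function on the lattice of twice the
dimension. -/
def sumCoeff (A : Zn n → Zn n → ℂ) (m : Fin n ⊕ Fin n → ℤ) : ℂ :=
  A (fun i => m (Sum.inl i)) fun i => m (Sum.inr i)

lemma sigmaA_sumEquiv (A : Zn n → Zn n → ℂ) (Φ : Rn n × Rn n → ℂ) (u : Fin n ⊕ Fin n → ℝ) :
    sigmaA A Φ (sumEquiv n u) = latticeSum intVec (sumCoeff A) (Φ ∘ sumEquiv n) u :=
  ((Equiv.sumPiEquivProdPi fun _ : Fin n ⊕ Fin n => ℤ).tsum_eq fun μν : Zn n × Zn n =>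
    A μν.1 μν.2 *
      Φ ((sumEquiv n u).1 - coeZ μν.1, (sumEquiv n u).2 - coeZ μν.2)).symm

lemma sigmaA_eq (A : Zn n → Zn n → ℂ) (Φ : Rn n × Rn n → ℂ) :
    sigmaA A Φ = latticeSum intVec (sumCoeff A) (Φ ∘ sumEquiv n) ∘ (sumEquiv n).symm := by
  funext p
  rw [Function.comp_apply, ← sigmaA_sumEquiv, ContinuousLinearEquiv.apply_symm_apply]

lemma IsCcInfty.comp_sumEquiv {Φ : Rn n × Rn n → ℂ} (h : IsCcInfty Φ) :
    IsCcInfty (Φ ∘ sumEquiv n) :=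
  ⟨h.1.comp (sumEquiv n).contDiff, h.2.comp_homeomorph (sumEquiv n).toHomeomorph⟩

lemma integral_mul_translate_comp_sumEquiv {Θ Φ : Rn n × Rn n → ℂ}
    (h : ∀ α β : Zn n, (∫ p : Rn n × Rn n, Θ p * Φ (p.1 - coeZ α, p.2 - coeZ β)) =
      if α = 0 ∧ β = 0 then 1 else 0) (α : Fin n ⊕ Fin n → ℤ) :
    (∫ x, (Θ ∘ sumEquiv n) x * (Φ ∘ sumEquiv n) (x - intVec α)) = if α = 0 then 1 else 0 := by
  have h1 := h (fun i => α (Sum.inl i)) fun i => α (Sum.inr i)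
  rw [← (measurePreserving_sumEquiv n).integral_comp
    (sumEquiv n).toHomeomorph.measurableEmbedding] at h1
  refine h1.trans (if_congr ?_ rfl rfl)
  simp only [funext_iff, Sum.forall, Pi.zero_apply]

end Splitting

/-- transfer of the lower bound from a `Φ` satisfying condition (A)
to an arbitrary `Φ̃ ∈ C_c^∞`. -/
theorem statement7 (n : ℕ) (Φ Φt : Rn n × Rn n → ℂ) (hΦ : IsCcInfty Φ) (hΦt : IsCcInfty Φt)
    (hcondA : ConditionA2 Φ) :
    ∃ c : ℝ≥0∞, c < ∞ ∧
      ∀ A : Zn n → Zn n → ℂ, IsLinftyMatrix A →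
        multNorm ⊤ (sigmaA A Φt) ≤ c * multNorm ⊤ (sigmaA A Φ) := by
  obtain ⟨Θ, hΘ, hΘs, hdual⟩ := hcondA
  have hΦ' := hΦ.comp_sumEquiv
  have hΦt' := hΦt.comp_sumEquiv
  have hΘ' : IsCcInfty (Θ ∘ sumEquiv n) := IsCcInfty.comp_sumEquiv ⟨hΘ, hΘs⟩
  have hk := integrable_kernelCoeff hΘ'.1 hΘ'.2 hΦt'.1 hΦt'.2
  refine ⟨∫⁻ z, ‖kernelCoeff (Θ ∘ sumEquiv n) (Φt ∘ sumEquiv n) z‖ₑ ∂(Measure.count.prod volume),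
    hk.hasFiniteIntegral, fun A hA => ?_⟩
  obtain ⟨C, hC⟩ := hA
  have hA' : ∃ C : ℝ, ∀ m, ‖sumCoeff A m‖ ≤ C := ⟨C, fun m => hC _ _⟩
  refine multNorm_top_le_of_integral (a := fun z => sumEquiv n (intVec z.1))
    (y := fun z => sumEquiv n z.2) hk
    (stronglyMeasurable_kernelCoeff hΘ'.1.continuous hΦt'.1.continuous).measurable
    ((sumEquiv n).continuous.comp (continuous_intVec.comp continuous_fst)).measurable
    ((sumEquiv n).continuous.measurable.comp measurable_snd) ?_ ?_ fun p => ?_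
  · have hcont : Continuous (latticeSum intVec (sumCoeff A) (Φ ∘ sumEquiv n)) :=
      continuous_latticeSum (tendsto_intVec (d := Fin n ⊕ Fin n)) hΦ'.2 hΦ'.1.continuous _
    rw [sigmaA_eq]
    exact hcont.comp (sumEquiv n).symm.continuous
  · obtain ⟨B, hB⟩ := exists_norm_latticeSum_le hΦ'.1.continuous hΦ'.2 hA'
    exact ⟨B, fun p => by rw [sigmaA_eq]; exact hB _⟩
  · obtain ⟨u, rfl⟩ := (sumEquiv n).surjective p
    simp only [sumEquiv_dotProduct, ← map_add, sigmaA_sumEquiv]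
    exact latticeSum_eq_integral_kernelCoeff hΘ'.1 hΘ'.2 hΦ'.1.continuous hΦ'.2 hΦt'.1 hΦt'.2
      (integral_mul_translate_comp_sumEquiv hdual) hA' u
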